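/- Suppose U has nonempty interior, g extends to a continuously differentiable map on an open neighbourhood of U × X with g(U × X) ⊆ X, and let m ∈ ℕ satisfy m·N_in ≥ N_r. Define F: U^m × X → ℝ^{N_r} by F(ū, x) = g(ū_1, g(ū_2, …, g(ū_m, x) … )) for ū = (ū_1, …, ū_m) ∈ U^m. Assume (G1) ‖D₂g(u, x)‖₂ < 1 for all (u, x) ∈ U × X, where D₂g denotes the partial derivative of g with respect to the state variable; and (G2) there exist z ∈ X and v̄ ∈ (int U)^m with z = F(v̄, z) such that the linear map D₁F(v̄, z): ℝ^{m·N_in} → ℝ^{N_r} is surjective, where D₁F denotes the partial derivative of F with respect to the input variable. Then the set S = { x ∈ ℝ^{N_r} : ∃ ū ∈ U^m with F(ū, x) = x } contains a nonempty open subset of ℝ^{N_r}; in particular S is compact with box-counting dimension dim_B S = N_r. -/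

import Mathlib

open Filter Topology
open scoped ENNReal

noncomputable section

/-- Euclidean space `ℝ^n`. -/
abbrev EVec (n : ℕ) : Type := EuclideanSpace ℝ (Fin n)

/-- The `m`-fold iteration map `F(ū, x) = g(ū₁, g(ū₂, …, g(ū_m, x)…))`
(with `ub 0 = ū₁` the outermost input). -/
def iterF {Nin Nr : ℕ} (g : EVec Nin × EVec Nr → EVec Nr) :
    (m : ℕ) → (Fin m → EVec Nin) → EVec Nr → EVec Nr
  | 0, _, x => x
  | m + 1, u, x => g (u 0, iterF g m (fun i => u i.succ) x)

/-- `N(s, ε)`: the minimal number of balls of radius `ε` (for the distance `d`) with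
centres in `s` needed to cover `s`. -/
def coverN {α : Type*} (d : α → α → ℝ) (s : Set α) (ε : ℝ) : ℕ :=
  sInf {k : ℕ | ∃ t : Finset α, ↑t ⊆ s ∧ (∀ x ∈ s, ∃ c ∈ t, d c x < ε) ∧ t.card = k}

/-- The upper box-counting dimension `dim_B s = limsup_{ε→0⁺} log N(s,ε) / (−log ε)`,
valued in `ℝ≥0∞`. -/
def dimB {α : Type*} (d : α → α → ℝ) (s : Set α) : ℝ≥0∞ :=
  Filter.limsup (fun ε : ℝ => ENNReal.ofReal (Real.log (coverN d s ε) / (-Real.log ε)))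
    (nhdsWithin 0 (Set.Ioi 0))


lemma aux_mem {Nin Nr : ℕ} {U : Set (EVec Nin)} {X : Set (EVec Nr)}
    {g : EVec Nin × EVec Nr → EVec Nr} (hmaps : Set.MapsTo g (U ×ˢ X) X) :
    ∀ (m : ℕ) (u : Fin m → EVec Nin) (x : EVec Nr), (∀ i, u i ∈ U) → x ∈ X → iterF g m u x ∈ X
  | 0, _, _, _, hx => hx
  | m + 1, u, x, hu, hx =>
    hmaps ⟨hu 0, aux_mem hmaps m (fun i => u i.succ) x (fun i => hu i.succ) hx⟩

lemma aux_contDiffAt {Nin Nr : ℕ} {U : Set (EVec Nin)} {X : Set (EVec Nr)}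
    {g : EVec Nin × EVec Nr → EVec Nr} {O : Set (EVec Nin × EVec Nr)}
    (hO : IsOpen O) (hUXO : U ×ˢ X ⊆ O) (hg : ContDiffOn ℝ 1 g O)
    (hmaps : Set.MapsTo g (U ×ˢ X) X) :
    ∀ (m : ℕ) (u : Fin m → EVec Nin) (x : EVec Nr), (∀ i, u i ∈ U) → x ∈ X →
      ContDiffAt ℝ 1 (fun p : (Fin m → EVec Nin) × EVec Nr => iterF g m p.1 p.2) (u, x)
  | 0, _, _, _, _ => by
    simp only [iterF]
    exact contDiffAt_snd
  | m + 1, u, x, hu, hx => by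
    have ih := aux_contDiffAt hO hUXO hg hmaps m (fun i => u i.succ) x (fun i => hu i.succ) hx
    have hmem : (u 0, iterF g m (fun i => u i.succ) x) ∈ O :=
      hUXO ⟨hu 0, aux_mem hmaps m _ x (fun i => hu i.succ) hx⟩
    have hgat : ContDiffAt ℝ 1 g (u 0, iterF g m (fun i => u i.succ) x) :=
      hg.contDiffAt (hO.mem_nhds hmem)
    have h1 : ContDiffAt ℝ 1 (fun p : (Fin (m+1) → EVec Nin) × EVec Nr =>
        ((fun i : Fin m => p.1 i.succ), p.2)) (u, x) := by fun_prop
    have h2 : ContDiffAt ℝ 1 (fun p : (Fin (m+1) → EVec Nin) × EVec Nr =>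
        iterF g m (fun i => p.1 i.succ) p.2) (u, x) :=
      ContDiffAt.comp (u, x) (g := fun p : (Fin m → EVec Nin) × EVec Nr => iterF g m p.1 p.2) ih h1
    have h3 : ContDiffAt ℝ 1 (fun p : (Fin (m+1) → EVec Nin) × EVec Nr => p.1 0) (u, x) := by
      fun_prop
    simp only [iterF]
    exact ContDiffAt.comp (u, x) (g := g) hgat (h3.prodMk h2)

open MeasureTheory Metric in
lemma aux_lower {n : ℕ} {z : EVec n} {r ε : ℝ} (hr : 0 < r) (hε : 0 < ε) (t : Finset (EVec n))
    (ht : ∀ x ∈ ball z r, ∃ c ∈ t, dist c x < ε) : r ^ n ≤ t.card * ε ^ n := by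
  have hsub : ball z r ⊆ ⋃ c ∈ t, ball c ε := by
    intro x hx
    obtain ⟨c, hc, hd⟩ := ht x hx
    simp only [Set.mem_iUnion]
    exact ⟨c, hc, by rwa [mem_ball, dist_comm]⟩
  have h1 := (measure_mono hsub).trans (measure_biUnion_finset_le (μ := (volume : Measure (EVec n))) t _)
  simp only [Measure.addHaar_ball_of_pos _ _ hr, Measure.addHaar_ball_of_pos _ _ hε,
    Finset.sum_const, nsmul_eq_mul, ← mul_assoc] at h1
  have hb0 : volume (ball (0 : EVec n) 1) ≠ 0 := (measure_ball_pos _ _ one_pos).ne'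
  have hbt : volume (ball (0 : EVec n) 1) ≠ ⊤ := measure_ball_lt_top.ne
  rw [ENNReal.mul_le_mul_iff_left hb0 hbt] at h1
  rw [← ENNReal.ofReal_natCast, ← ENNReal.ofReal_mul (by positivity)] at h1
  rw [ENNReal.ofReal_le_ofReal_iff (by positivity)] at h1
  simpa using h1

open MeasureTheory Metric in
lemma aux_upper {n : ℕ} {R ε : ℝ} (hR : 0 < R) (hε : 0 < ε) (hε1 : ε ≤ 1) (t : Finset (EVec n))
    (ht : ∀ x ∈ t, x ∈ ball (0 : EVec n) R)
    (hs : ∀ x ∈ t, ∀ y ∈ t, x ≠ y → ε ≤ dist x y) : t.card * (ε / 2) ^ n ≤ (R + 1) ^ n := by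
  have hsub : (⋃ c ∈ t, ball c (ε / 2)) ⊆ ball (0 : EVec n) (R + 1) := by
    intro x hx
    simp only [Set.mem_iUnion] at hx
    obtain ⟨c, hc, hd⟩ := hx
    have := ht c hc
    rw [mem_ball] at *
    have := dist_triangle x c 0
    linarith
  have hdis : (t : Set (EVec n)).PairwiseDisjoint (fun c => ball c (ε / 2)) := by
    intro x hx y hy hxy
    apply ball_disjoint_ball
    have := hs x hx y hy hxy
    linarith
  have h1 := measure_mono (μ := (volume : Measure (EVec n))) hsub
  rw [measure_biUnion_finset hdis (fun _ _ => measurableSet_ball)] at h1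
  simp only [Measure.addHaar_ball_of_pos _ _ (show 0 < R + 1 by linarith),
    Measure.addHaar_ball_of_pos _ _ (half_pos hε),
    Finset.sum_const, nsmul_eq_mul, ← mul_assoc] at h1
  have hb0 : volume (ball (0 : EVec n) 1) ≠ 0 := (measure_ball_pos _ _ one_pos).ne'
  have hbt : volume (ball (0 : EVec n) 1) ≠ ⊤ := measure_ball_lt_top.ne
  rw [ENNReal.mul_le_mul_iff_left hb0 hbt] at h1
  rw [← ENNReal.ofReal_natCast, ← ENNReal.ofReal_mul (by positivity)] at h1
  rw [ENNReal.ofReal_le_ofReal_iff (by positivity)] at h1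
  simpa using h1

open Metric in
lemma aux_cover {n : ℕ} {S : Set (EVec n)} {R ε : ℝ} (hR : 0 < R) (hS : S ⊆ ball 0 R)
    (hε : 0 < ε) (hε1 : ε ≤ 1) :
    ∃ t : Finset (EVec n), ↑t ⊆ S ∧ (∀ x ∈ S, ∃ c ∈ t, dist c x < ε) ∧
      t.card * (ε / 2) ^ n ≤ (R + 1) ^ n := by
  classical
  let P : Set ℕ := {k | ∃ t : Finset (EVec n), ↑t ⊆ S ∧
    (∀ x ∈ t, ∀ y ∈ t, x ≠ y → ε ≤ dist x y) ∧ t.card = k}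
  have hne : P.Nonempty := ⟨0, ∅, by simp⟩
  have hbd : BddAbove P := by
    refine ⟨⌊(R + 1) ^ n / (ε / 2) ^ n⌋₊, ?_⟩
    rintro k ⟨t, htS, hts, rfl⟩
    apply Nat.le_floor
    rw [le_div_iff₀ (by positivity)]
    exact aux_upper hR hε hε1 t (fun x hx => hS (htS hx)) hts
  obtain ⟨t, htS, hts, htc⟩ := Nat.sSup_mem hne hbd
  refine ⟨t, htS, ?_, aux_upper hR hε hε1 t (fun x hx => hS (htS hx)) hts⟩
  intro x hx
  by_contra! hcon
  have hxt : x ∉ t := fun h => by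
    have := hcon x h
    rw [dist_self] at this
    linarith
  have hmem : t.card + 1 ∈ P := by
    refine ⟨insert x t, ?_, ?_, Finset.card_insert_of_notMem hxt⟩
    · intro y hy
      rcases Finset.mem_insert.1 hy with rfl | hy
      · exact hx
      · exact htS hy
    · intro a ha b hb hab
      rcases Finset.mem_insert.1 ha with rfl | ha2
      · rcases Finset.mem_insert.1 hb with rfl | hb
        · exact absurd rfl hab
        · rw [dist_comm]; exact hcon b hb
      · rcases Finset.mem_insert.1 hb with rfl | hb
        · exact hcon a ha2
        · exact hts a ha2 b hb hab
  have := le_csSup hbd hmem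
  omega

open Metric in
lemma aux_dim {n : ℕ} {S : Set (EVec n)} {R r : ℝ} {z : EVec n} (hR : 0 < R) (hS : S ⊆ ball 0 R)
    (hr : 0 < r) (hz : ball z r ⊆ S) : dimB (fun a b : EVec n => dist a b) S = (n : ℝ≥0∞) := by
  have hlow : ∀ ε : ℝ, 0 < ε → ε ≤ 1 →
      r ^ n ≤ (coverN (fun a b : EVec n => dist a b) S ε : ℝ) * ε ^ n ∧
      (coverN (fun a b : EVec n => dist a b) S ε : ℝ) * (ε / 2) ^ n ≤ (R + 1) ^ n := by
    intro ε hε hε1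
    obtain ⟨t, htS, htc, hcard⟩ := aux_cover hR hS hε hε1
    constructor
    · have hne : {k : ℕ | ∃ t : Finset (EVec n), ↑t ⊆ S ∧
          (∀ x ∈ S, ∃ c ∈ t, dist c x < ε) ∧ t.card = k}.Nonempty := ⟨t.card, t, htS, htc, rfl⟩
      obtain ⟨t', _, ht'c, ht'⟩ := Nat.sInf_mem hne
      unfold coverN
      rw [← ht']
      exact aux_lower hr hε t' (fun x hx => ht'c x (hz hx))
    · have h : coverN (fun a b : EVec n => dist a b) S ε ≤ t.card :=
        Nat.sInf_le ⟨t, htS, htc, rfl⟩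
      refine le_trans ?_ hcard
      gcongr
  have hev : ∀ᶠ ε : ℝ in nhdsWithin 0 (Set.Ioi 0), 0 < ε ∧ ε < 1 :=
    Ioo_mem_nhdsGT (by norm_num : (0:ℝ) < 1)
  have hinv : Tendsto (fun ε : ℝ => (-Real.log ε)⁻¹) (nhdsWithin 0 (Set.Ioi 0)) (𝓝 0) :=
    tendsto_inv_atTop_zero.comp (tendsto_neg_atBot_atTop.comp Real.tendsto_log_nhdsGT_zero)
  have hlim : ∀ C : ℝ, Tendsto (fun ε : ℝ => C * (-Real.log ε)⁻¹ + n)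
      (nhdsWithin 0 (Set.Ioi 0)) (𝓝 (n : ℝ)) := by
    intro C
    simpa using (hinv.const_mul C).add_const (n : ℝ)
  have key : Tendsto (fun ε : ℝ =>
      Real.log (coverN (fun a b : EVec n => dist a b) S ε) / (-Real.log ε))
      (nhdsWithin 0 (Set.Ioi 0)) (𝓝 (n : ℝ)) := by
    refine tendsto_of_tendsto_of_tendsto_of_le_of_le' (hlim (n * Real.log r))
      (hlim (n * Real.log (R + 1) + n * Real.log 2)) ?_ ?_
    · filter_upwards [hev] with ε ⟨h0, h1⟩
      have hl : 0 < -Real.log ε := by linarith [Real.log_neg h0 h1]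
      have h := (hlow ε h0 h1.le).1
      have hN : 0 < (coverN (fun a b : EVec n => dist a b) S ε : ℝ) := by
        by_contra! hc
        have : 0 < r ^ n := by positivity
        have h2 : 0 < ε ^ n := by positivity
        nlinarith
      have h3 := Real.log_le_log (by positivity) h
      rw [Real.log_mul hN.ne' (by positivity), Real.log_pow, Real.log_pow] at h3
      rw [le_div_iff₀ hl, add_mul, mul_assoc, inv_mul_cancel₀ hl.ne']
      linarith
    · filter_upwards [hev] with ε ⟨h0, h1⟩
      have hl : 0 < -Real.log ε := by linarith [Real.log_neg h0 h1]
      have h := (hlow ε h0 h1.le).1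
      have hN : 0 < (coverN (fun a b : EVec n => dist a b) S ε : ℝ) := by
        by_contra! hc
        have : 0 < r ^ n := by positivity
        have h2 : 0 < ε ^ n := by positivity
        nlinarith
      have h3 := Real.log_le_log (by positivity) (hlow ε h0 h1.le).2
      rw [Real.log_mul hN.ne' (by positivity), Real.log_pow, Real.log_pow,
        Real.log_div h0.ne' (by norm_num)] at h3
      rw [div_le_iff₀ hl, add_mul, mul_assoc, inv_mul_cancel₀ hl.ne']
      linarith
  unfold dimB
  have := (ENNReal.tendsto_ofReal key).limsup_eq
  rw [this, ENNReal.ofReal_natCast]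

/-- Suppose `U` has nonempty interior, `g` extends to a `C¹` map on an
open neighbourhood of `U × X` with `g(U × X) ⊆ X`, and `m·N_in ≥ N_r`.  Let
`F(ū, x) = g(ū₁, g(ū₂, …, g(ū_m, x)…))` and assume
(G1) `‖D₂g(u,x)‖₂ < 1` for all `(u,x) ∈ U × X`, and
(G2) there are `z ∈ X` and `v̄ ∈ (int U)^m` with `z = F(v̄, z)` such that
`D₁F(v̄, z)` is surjective.  Then `S = { x : ∃ ū ∈ U^m, F(ū, x) = x }` contains a
nonempty open subset of `ℝ^{N_r}`; in particular `S` is compact with `dim_B S = N_r`. -/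
theorem stmt11 (Nin Nr m : ℕ) (U : Set (EVec Nin)) (X : Set (EVec Nr))
    (hU : IsCompact U) (hX : IsCompact X)
    (hUint : (interior U).Nonempty)
    (hm : Nr ≤ m * Nin)
    (g : EVec Nin × EVec Nr → EVec Nr) (O : Set (EVec Nin × EVec Nr))
    (hO : IsOpen O) (hUXO : U ×ˢ X ⊆ O) (hg : ContDiffOn ℝ 1 g O)
    (hmaps : Set.MapsTo g (U ×ˢ X) X)
    -- (G1)
    (hG1 : ∀ u ∈ U, ∀ x ∈ X, ‖fderiv ℝ (fun y => g (u, y)) x‖ < 1)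
    -- (G2)
    (hG2 : ∃ z ∈ X, ∃ vb : Fin m → EVec Nin, (∀ i, vb i ∈ interior U) ∧
      iterF g m vb z = z ∧
      Function.Surjective ⇑(fderiv ℝ (fun ub : Fin m → EVec Nin => iterF g m ub z) vb)) :
    (∃ V : Set (EVec Nr), IsOpen V ∧ V.Nonempty ∧
      V ⊆ {x : EVec Nr | x ∈ X ∧ ∃ ub : Fin m → EVec Nin, (∀ i, ub i ∈ U) ∧ iterF g m ub x = x}) ∧
    IsCompact {x : EVec Nr | x ∈ X ∧ ∃ ub : Fin m → EVec Nin, (∀ i, ub i ∈ U) ∧ iterF g m ub x = x} ∧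
    dimB (fun a b : EVec Nr => dist a b)
      {x : EVec Nr | x ∈ X ∧ ∃ ub : Fin m → EVec Nin, (∀ i, ub i ∈ U) ∧ iterF g m ub x = x} =
      (Nr : ℝ≥0∞) := by
  set S := {x : EVec Nr | x ∈ X ∧ ∃ ub : Fin m → EVec Nin, (∀ i, ub i ∈ U) ∧ iterF g m ub x = x}
    with hSdef
  have hcd := aux_contDiffAt hO hUXO hg hmaps m
  obtain ⟨z, hzX, vb, hvb, hfix, hsurj⟩ := hG2
  have hvU : ∀ i, vb i ∈ U := fun i => interior_subset (hvb i)
  -- the interior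
  have hint : S ∈ 𝓝 z := by
    have hstr := (hcd vb z hvU hzX).hasStrictFDerivAt (by norm_num)
    set f' := fderiv ℝ (fun p : (Fin m → EVec Nin) × EVec Nr => iterF g m p.1 p.2) (vb, z)
    have hpart : HasStrictFDerivAt (fun ub : Fin m → EVec Nin => iterF g m ub z)
        (f' ∘L ContinuousLinearMap.inl ℝ _ _) vb :=
      HasStrictFDerivAt.comp (g := fun p : (Fin m → EVec Nin) × EVec Nr => iterF g m p.1 p.2)
        (f := fun u : Fin m → EVec Nin => (u, z)) vb hstr ((hasStrictFDerivAt_id vb).prodMk (hasStrictFDerivAt_const z vb))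
    rw [hpart.hasFDerivAt.fderiv] at hsurj
    have hN : {u : Fin m → EVec Nin | ∀ i, u i ∈ U} ∈ 𝓝 vb := by
      have : Set.pi Set.univ (fun _ : Fin m => U) ∈ 𝓝 vb :=
        set_pi_mem_nhds Set.finite_univ (fun i _ => mem_interior_iff_mem_nhds.1 (hvb i))
      filter_upwards [this] with u hu i using hu i trivial
    have hXn : X ∈ 𝓝 z := by
      have h1 := hpart.map_nhds_eq_of_surj (LinearMap.range_eq_top.2 hsurj)
      rw [hfix] at h1
      rw [← h1, Filter.mem_map]
      filter_upwards [hN] with u hu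
      exact aux_mem hmaps m u z hu hzX
    have hpsi : HasStrictFDerivAt
        (fun p : (Fin m → EVec Nin) × EVec Nr => (iterF g m p.1 p.2 - p.2, p.2))
        ((f' - ContinuousLinearMap.snd ℝ _ _).prod (ContinuousLinearMap.snd ℝ _ _)) (vb, z) :=
      (hstr.sub hasStrictFDerivAt_snd).prodMk hasStrictFDerivAt_snd
    have hps : Function.Surjective
        ((f' - ContinuousLinearMap.snd ℝ _ _).prod (ContinuousLinearMap.snd ℝ _ _)) := by
      rintro ⟨a, b⟩
      obtain ⟨w, hw⟩ := hsurj (a + b - f' (0, b))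
      refine ⟨(w, b), ?_⟩
      have h2 : f' (w, b) = f' (w, 0) + f' (0, b) := by rw [← map_add]; simp
      have h3 : f' (w, 0) = a + b - f' (0, b) := by simpa using hw
      simp [h2, h3]
    have h1 := hpsi.map_nhds_eq_of_surj (LinearMap.range_eq_top.2 hps)
    simp only [hfix, sub_self] at h1
    have hN' : {p : (Fin m → EVec Nin) × EVec Nr | ∀ i, p.1 i ∈ U} ∈ 𝓝 (vb, z) :=
      (continuous_fst.tendsto (vb, z)).eventually hN
    have h2 := Filter.image_mem_map (m := fun p : (Fin m → EVec Nin) × EVec Nr =>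
      (iterF g m p.1 p.2 - p.2, p.2)) hN'
    rw [h1] at h2
    have h3 := (Continuous.prodMk_right (X := EVec Nr) (Y := EVec Nr) 0).continuousAt.preimage_mem_nhds
      (x := z) h2
    filter_upwards [hXn, h3] with x hx hx3
    obtain ⟨⟨u, y⟩, hu, he⟩ := hx3
    simp only [Prod.mk.injEq] at he
    obtain ⟨he1, rfl⟩ := he
    exact ⟨hx, u, hu, sub_eq_zero.1 he1⟩
  have hcomp : IsCompact S := by
    have hK : IsCompact ((Set.pi Set.univ (fun _ : Fin m => U)) ×ˢ X) :=
      (isCompact_univ_pi (fun _ => hU)).prod hX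
    have hcont : ContinuousOn (fun p : (Fin m → EVec Nin) × EVec Nr => iterF g m p.1 p.2 - p.2)
        ((Set.pi Set.univ (fun _ : Fin m => U)) ×ˢ X) := by
      rintro ⟨u, x⟩ ⟨hu, hx⟩
      exact ((hcd u x (fun i => hu i trivial) hx).continuousAt.sub
        continuousAt_snd).continuousWithinAt
    have hcl := hcont.preimage_isClosed_of_isClosed hK.isClosed (isClosed_singleton (x := 0))
    have := (hK.of_isClosed_subset hcl Set.inter_subset_left).image continuous_snd
    convert this using 1
    ext x
    constructor
    · rintro ⟨hx, u, hu, he⟩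
      exact ⟨(u, x), ⟨⟨fun i _ => hu i, hx⟩, by simp [he]⟩, rfl⟩
    · rintro ⟨⟨u, y⟩, ⟨⟨hu, hy⟩, he⟩, rfl⟩
      exact ⟨hy, u, fun i => hu i trivial, sub_eq_zero.1 he⟩
  refine ⟨⟨interior S, isOpen_interior, ⟨z, mem_interior_iff_mem_nhds.2 hint⟩, interior_subset⟩,
    hcomp, ?_⟩
  obtain ⟨r, hr, hball⟩ := Metric.mem_nhds_iff.1 hint
  obtain ⟨R, hR, hSR⟩ := hcomp.isBounded.subset_ball_lt 0 0
  exact aux_dim hR hSR hr hball
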